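/- For every n ≥ 1 there do not exist vectors β_1, …, β_6 ∈ ℝ^n, each of the form ±e_i ± e_j for some 1 ≤ i < j ≤ n, whose Gram matrix (⟪β_r, β_s⟫)_{1 ≤ r, s ≤ 6} equals the partial Cartan matrix of the Carter diagram E_6(a_2), namely the matrix with rows (2,0,0,−1,0,1), (0,2,0,−1,1,0), (0,0,2,−1,−1,−1), (−1,−1,−1,2,0,0), (0,1,−1,0,2,0), (1,0,−1,0,0,2). In other words, no root subset of D_n realizes the Carter diagram E_6(a_2). -/

import Mathlib

open RealInnerProductSpace

/-- A root of the root system `D_n` inside `ℝ^n`: a vector of the form `±e_i ± e_j`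
with `i < j`. -/
def IsRootDn (n : ℕ) (x : EuclideanSpace ℝ (Fin n)) : Prop :=
  ∃ i j : Fin n, i < j ∧
    (x = EuclideanSpace.single i (1 : ℝ) + EuclideanSpace.single j (1 : ℝ) ∨
     x = EuclideanSpace.single i (1 : ℝ) - EuclideanSpace.single j (1 : ℝ) ∨
     x = -EuclideanSpace.single i (1 : ℝ) + EuclideanSpace.single j (1 : ℝ) ∨
     x = -EuclideanSpace.single i (1 : ℝ) - EuclideanSpace.single j (1 : ℝ))

/-- The partial Cartan matrix of the Carter diagram `E₆(a₂)`. -/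
def partialCartanE6a2 : Matrix (Fin 6) (Fin 6) ℝ :=
  !![ 2,  0,  0, -1,  0,  1;
      0,  2,  0, -1,  1,  0;
      0,  0,  2, -1, -1, -1;
     -1, -1, -1,  2,  0,  0;
      0,  1, -1,  0,  2,  0;
      1,  0, -1,  0,  0,  2]

namespace IsRootDn

variable {n : ℕ} {w x y : EuclideanSpace ℝ (Fin n)}

/-- A root of `D_n` is a signed sum of two basis vectors. -/
lemma exists_single_add_single (h : IsRootDn n x) :
    ∃ (i j : Fin n) (a b : ℝ), i ≠ j ∧ (a = 1 ∨ a = -1) ∧ (b = 1 ∨ b = -1) ∧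
      x = EuclideanSpace.single i a + EuclideanSpace.single j b := by
  obtain ⟨i, j, hij, h | h | h | h⟩ := h
  · exact ⟨i, j, 1, 1, hij.ne, by simp, by simp, h⟩
  · exact ⟨i, j, 1, -1, hij.ne, by simp, by simp, by
      rw [h, sub_eq_add_neg, ← PiLp.single_neg]⟩
  · exact ⟨i, j, -1, 1, hij.ne, by simp, by simp, by
      rw [h, ← PiLp.single_neg]⟩
  · exact ⟨i, j, -1, -1, hij.ne, by simp, by simp, by
      rw [h, sub_eq_add_neg, ← PiLp.single_neg, ← PiLp.single_neg]⟩

/-- The coordinates of a root of `D_n` are `0`, `1` or `-1`. -/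
lemma coord_eq (h : IsRootDn n x) (p : Fin n) : x p = 0 ∨ x p = 1 ∨ x p = -1 := by
  obtain ⟨i, j, a, b, hij, ha, hb, rfl⟩ := h.exists_single_add_single
  by_cases hi : p = i
  · subst hi
    simpa [hij] using Or.inr ha
  · by_cases hj : p = j
    · subst hj
      simpa [hi] using Or.inr hb
    · simp [hi, hj]

/-- Two orthogonal roots sharing a nonzero coordinate at `p` add up to a multiple of `e_p`. -/
lemma add_eq_single (hx : IsRootDn n x) (hxx : ⟪x, x⟫ = 2) (hyy : ⟪y, y⟫ = 2)
    (hxy : ⟪x, y⟫ = 0) {p : Fin n} (hp : x p = y p) (h0 : x p ≠ 0) :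
    x + y = EuclideanSpace.single p (2 * x p) := by
  have hsq : x p * x p = 1 := by
    rcases hx.coord_eq p with h | h | h
    · exact absurd h h0
    all_goals rw [h]; norm_num
  rw [← sub_eq_zero, ← inner_self_eq_zero (𝕜 := ℝ)]
  simp only [inner_sub_left, inner_sub_right, inner_add_left, inner_add_right, hxx, hyy, hxy,
    real_inner_comm x y, EuclideanSpace.inner_single_left, EuclideanSpace.inner_single_right]
  simp [← hp]
  linarith

/-- Two orthogonal roots sharing a nonzero coordinate have inner products of the same parity
with any root. -/
lemma inner_add_inner_ne (hw : IsRootDn n w) (hx : IsRootDn n x) (hxx : ⟪x, x⟫ = 2)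
    (hyy : ⟪y, y⟫ = 2) (hxy : ⟪x, y⟫ = 0) {p : Fin n} (hp : x p = y p) (h0 : x p ≠ 0) :
    ⟪x, w⟫ + ⟪y, w⟫ ≠ 1 ∧ ⟪x, w⟫ + ⟪y, w⟫ ≠ -1 := by
  rw [← inner_add_left, hx.add_eq_single hxx hyy hxy hp h0, EuclideanSpace.inner_single_left]
  rcases hx.coord_eq p with h | h | h <;> rcases hw.coord_eq p with h' | h' | h' <;>
    rw [h, h'] <;> norm_num

/-- Among three roots having inner product `-1` with a given root, two share a nonzero
coordinate. -/
lemma exists_common_coord {z : EuclideanSpace ℝ (Fin n)} (hw : IsRootDn n w)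
    (hx : IsRootDn n x) (hy : IsRootDn n y) (hz : IsRootDn n z)
    (hxw : ⟪x, w⟫ = -1) (hyw : ⟪y, w⟫ = -1) (hzw : ⟪z, w⟫ = -1) :
    ∃ p, (x p = y p ∧ x p ≠ 0) ∨ (x p = z p ∧ x p ≠ 0) ∨ (y p = z p ∧ y p ≠ 0) := by
  obtain ⟨i, j, a, b, -, ha, hb, rfl⟩ := hw.exists_single_add_single
  have key : ∀ v, IsRootDn n v →
      ⟪v, EuclideanSpace.single i a + EuclideanSpace.single j b⟫ = -1 →
      v i = -a ∨ v j = -b := by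
    intro v hv h
    simp only [inner_add_right, EuclideanSpace.inner_single_right, conj_trivial] at h
    rcases ha with rfl | rfl <;> rcases hb with rfl | rfl <;>
      rcases hv.coord_eq i with h1 | h1 | h1 <;> rcases hv.coord_eq j with h2 | h2 | h2 <;>
      rw [h1, h2] at h ⊢ <;> revert h <;> norm_num
  have ha0 : -a ≠ 0 := by rcases ha with rfl | rfl <;> norm_num
  have hb0 : -b ≠ 0 := by rcases hb with rfl | rfl <;> norm_num
  have := key x hx hxw
  have := key y hy hyw
  have := key z hz hzw
  grind

end IsRootDn

/-- No root subset of `D_n` realizes the Carter diagram `E₆(a₂)`. -/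
theorem E6a2_not_realized_in_Dn (n : ℕ) (hn : 1 ≤ n) :
    ¬ ∃ β : Fin 6 → EuclideanSpace ℝ (Fin n),
      (∀ r, IsRootDn n (β r)) ∧ ∀ r s, ⟪β r, β s⟫ = partialCartanE6a2 r s := by
  rintro ⟨β, hβ, hG⟩
  obtain ⟨p, ⟨h, h0⟩ | ⟨h, h0⟩ | ⟨h, h0⟩⟩ :=
    (hβ 3).exists_common_coord (hβ 0) (hβ 1) (hβ 2)
      (by rw [hG]; simp [partialCartanE6a2]) (by rw [hG]; simp [partialCartanE6a2])
      (by rw [hG]; simp [partialCartanE6a2])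
  · refine ((hβ 4).inner_add_inner_ne (hβ 0) ?_ ?_ ?_ h h0).1 ?_ <;>
      rw [hG] <;> simp [hG, partialCartanE6a2]
  · refine ((hβ 4).inner_add_inner_ne (hβ 0) ?_ ?_ ?_ h h0).2 ?_ <;>
      rw [hG] <;> simp [hG, partialCartanE6a2]
  · refine ((hβ 5).inner_add_inner_ne (hβ 1) ?_ ?_ ?_ h h0).2 ?_ <;>
      rw [hG] <;> simp [hG, partialCartanE6a2]
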